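/- Let m₁, m₂, m₃ be nonnegative real numbers. Then there exists a unique tuple of nonnegative real numbers (a, b, c, l₁, l₂, l₃) satisfying m₁ = a + b + 2l₁, m₂ = a + c + 2l₂, m₃ = b + c + 2l₃, such that at most one of l₁, l₂, l₃ is nonzero, and such that l₁ ≠ 0 implies c = 0, l₂ ≠ 0 implies b = 0, and l₃ ≠ 0 implies a = 0. Moreover, the map sending (m₁, m₂, m₃) to this unique solution is continuous on the set of triples of nonnegative reals. -/

import Mathlib

/-- The combinatorial core of the weighted Dehn–Thurston Lemma for the pair of
pants: the nonnegative tuple `(a, b, c, l₁, l₂, l₃)` records the total weights of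
arcs joining the pairs of boundary components and of loops based at each boundary
component, realizing the total boundary weights `(m₁, m₂, m₃)`.  Disjointness
forces at most one `lᵢ` to be nonzero and a loop at `∂ᵢ` to exclude the arcs
joining the other two boundary components. -/
def IsPantsWeightData (m₁ m₂ m₃ : ℝ) (x : ℝ × ℝ × ℝ × ℝ × ℝ × ℝ) : Prop :=
  match x with
  | (a, b, c, l₁, l₂, l₃) =>
      0 ≤ a ∧ 0 ≤ b ∧ 0 ≤ c ∧ 0 ≤ l₁ ∧ 0 ≤ l₂ ∧ 0 ≤ l₃ ∧
      m₁ = a + b + 2 * l₁ ∧ m₂ = a + c + 2 * l₂ ∧ m₃ = b + c + 2 * l₃ ∧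
      (l₁ = 0 ∨ l₂ = 0) ∧ (l₁ = 0 ∨ l₃ = 0) ∧ (l₂ = 0 ∨ l₃ = 0) ∧
      (l₁ ≠ 0 → c = 0) ∧ (l₂ ≠ 0 → b = 0) ∧ (l₃ ≠ 0 → a = 0)

/-- The loop weight at a boundary component of total weight `p`, where `q` and `r` are the total
weights at the other two. -/
noncomputable def pantsLoopWeight (p q r : ℝ) : ℝ :=
  max 0 ((p - q - r) / 2)

/-- The weight of the arcs joining the boundary components of total weights `p` and `q`, where `r`
is the total weight at the third. -/
noncomputable def pantsArcWeight (p q r : ℝ) : ℝ :=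
  max 0 (min (min p q) ((p + q - r) / 2))

/-- The explicit solution of the weight equations on the pair of pants. -/
noncomputable def pantsWeights (m : ℝ × ℝ × ℝ) : ℝ × ℝ × ℝ × ℝ × ℝ × ℝ :=
  (pantsArcWeight m.1 m.2.1 m.2.2, pantsArcWeight m.1 m.2.2 m.2.1,
    pantsArcWeight m.2.1 m.2.2 m.1, pantsLoopWeight m.1 m.2.1 m.2.2,
    pantsLoopWeight m.2.1 m.1 m.2.2, pantsLoopWeight m.2.2 m.1 m.2.1)

theorem continuous_pantsWeights : Continuous pantsWeights := by
  unfold pantsWeights pantsArcWeight pantsLoopWeight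
  fun_prop

theorem isPantsWeightData_pantsWeights {m₁ m₂ m₃ : ℝ} (h₁ : 0 ≤ m₁) (h₂ : 0 ≤ m₂) (h₃ : 0 ≤ m₃) :
    IsPantsWeightData m₁ m₂ m₃ (pantsWeights (m₁, m₂, m₃)) := by
  simp only [IsPantsWeightData, pantsWeights, pantsArcWeight, pantsLoopWeight]
  refine ⟨?_, ?_, ?_, ?_, ?_, ?_, ?_, ?_, ?_, ?_, ?_, ?_, ?_, ?_, ?_⟩ <;> grind

theorem IsPantsWeightData.eq_pantsWeights {m₁ m₂ m₃ : ℝ} {x : ℝ × ℝ × ℝ × ℝ × ℝ × ℝ}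
    (h : IsPantsWeightData m₁ m₂ m₃ x) : x = pantsWeights (m₁, m₂, m₃) := by
  obtain ⟨a, b, c, l₁, l₂, l₃⟩ := x
  obtain ⟨ha, hb, hc, h₁, h₂, h₃, rfl, rfl, rfl, h₁₂, h₁₃, h₂₃, hc₁, hb₂, ha₃⟩ := h
  simp only [pantsWeights, pantsArcWeight, pantsLoopWeight, Prod.mk.injEq]
  refine ⟨?_, ?_, ?_, ?_, ?_, ?_⟩ <;> grind

/-- The weighted Dehn–Thurston Lemma for the pair of pants: every triple of
nonnegative real total weights is realized by a unique weighted arc data tuple,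
and the solution depends continuously on `(m₁, m₂, m₃)` on the set of
nonnegative triples. -/
theorem dehn_thurston_pants_real :
    (∀ m₁ m₂ m₃ : ℝ, 0 ≤ m₁ → 0 ≤ m₂ → 0 ≤ m₃ →
      ∃! x : ℝ × ℝ × ℝ × ℝ × ℝ × ℝ, IsPantsWeightData m₁ m₂ m₃ x) ∧
    ∃ f : ℝ × ℝ × ℝ → ℝ × ℝ × ℝ × ℝ × ℝ × ℝ,
      ContinuousOn f {m : ℝ × ℝ × ℝ | 0 ≤ m.1 ∧ 0 ≤ m.2.1 ∧ 0 ≤ m.2.2} ∧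
      ∀ m : ℝ × ℝ × ℝ, 0 ≤ m.1 → 0 ≤ m.2.1 → 0 ≤ m.2.2 →
        IsPantsWeightData m.1 m.2.1 m.2.2 (f m) := by
  exact ⟨fun _ _ _ h₁ h₂ h₃ =>
      ⟨_, isPantsWeightData_pantsWeights h₁ h₂ h₃, fun _ hx => hx.eq_pantsWeights⟩,
    pantsWeights, continuous_pantsWeights.continuousOn,
    fun _ h₁ h₂ h₃ => isPantsWeightData_pantsWeights h₁ h₂ h₃⟩
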